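/- arXiv:math/0306398 — 3 statements merged into one kernel-verified Lean document; each statement's English description precedes it below -/
import Mathlib

section
/- Let m ≥ 2, and for each i ∈ ℕ let B(cᵢ, rᵢ) be an open ball in Euclidean space ℝ^m with rᵢ > 0. Suppose the balls B(cᵢ, rᵢ) are pairwise disjoint and that the radii tend to zero, i.e., rᵢ → 0 as i → ∞. Then the complement ℝ^m \ ⋃ᵢ B(cᵢ, rᵢ) is path-connected: any two points of this set can be joined by a continuous path lying entirely in the set. -/
open Metric Filter Topology

/-- Radial projection out of the ball of center `c` and radius `r`. -/
noncomputable def radialOut {E : Type*} [NormedAddCommGroup E] [NormedSpace ℝ E]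
    (c : E) (r : ℝ) (z : E) : E := c + (max 1 (r / ‖z - c‖)) • (z - c)

section
variable {E : Type*} [NormedAddCommGroup E] [NormedSpace ℝ E]

lemma radialOut_of_notMem {c : E} {r : ℝ} (hr : 0 < r) {z : E} (hz : z ∉ ball c r) :
    radialOut c r z = z := by
  have h : r ≤ ‖z - c‖ := by simpa [dist_eq_norm] using hz
  have h1 : r / ‖z - c‖ ≤ 1 := div_le_one_of_le₀ h (norm_nonneg _)
  simp [radialOut, max_eq_left h1]

lemma radialOut_continuousAt {c : E} {r : ℝ} {z : E} (hz : z ≠ c) :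
    ContinuousAt (radialOut c r) z := by
  have h : ‖z - c‖ ≠ 0 := norm_ne_zero_iff.2 (sub_ne_zero.2 hz)
  unfold radialOut
  fun_prop (disch := assumption)

lemma radialOut_sub_center {c : E} {r : ℝ} (hr : 0 < r) {z : E} (hz : z ∈ ball c r)
    (hne : z ≠ c) : radialOut c r z = c + (r / ‖z - c‖) • (z - c) := by
  have h : ‖z - c‖ < r := by simpa [dist_eq_norm] using hz
  have h0 : 0 < ‖z - c‖ := norm_pos_iff.2 (sub_ne_zero.2 hne)
  have h1 : 1 ≤ r / ‖z - c‖ := (one_le_div h0).2 h.le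
  simp [radialOut, max_eq_right h1]

lemma radialOut_mem_sphere {c : E} {r : ℝ} (hr : 0 < r) {z : E} (hz : z ∈ ball c r)
    (hne : z ≠ c) : radialOut c r z ∈ sphere c r := by
  have h0 : 0 < ‖z - c‖ := norm_pos_iff.2 (sub_ne_zero.2 hne)
  rw [radialOut_sub_center hr hz hne, mem_sphere, dist_eq_norm, add_sub_cancel_left, norm_smul,
    Real.norm_of_nonneg (by positivity)]
  field_simp

lemma radialOut_dist {c : E} {r : ℝ} (hr : 0 < r) {z : E} (hz : z ∈ ball c r)
    (hne : z ≠ c) : dist (radialOut c r z) z ≤ 2 * r := by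
  have h1 := mem_sphere.1 (radialOut_mem_sphere hr hz hne)
  have h2 := mem_ball.1 hz
  have h3 := dist_triangle_right (radialOut c r z) z c
  linarith

open Classical in
/-- Radial projection out of a whole family of balls. -/
noncomputable def radialOutAll (c : ℕ → E) (r : ℕ → ℝ) (z : E) : E :=
  if h : ∃ i, z ∈ ball (c i) (r i) then radialOut (c h.choose) (r h.choose) z else z

lemma radialOutAll_cases (c : ℕ → E) (r : ℕ → ℝ) (z : E) :
    (∃ i, z ∈ ball (c i) (r i) ∧ radialOutAll c r z = radialOut (c i) (r i) z) ∨
    ((∀ i, z ∉ ball (c i) (r i)) ∧ radialOutAll c r z = z) := by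
  by_cases h : ∃ i, z ∈ ball (c i) (r i)
  · exact Or.inl ⟨h.choose, h.choose_spec, by simp only [radialOutAll, dif_pos h]⟩
  · exact Or.inr ⟨by simpa using h, by simp only [radialOutAll, dif_neg h]⟩

lemma radialOutAll_mem (c : ℕ → E) (r : ℕ → ℝ) (hr : ∀ i, 0 < r i)
    (hdisj : Pairwise fun i j => Disjoint (ball (c i) (r i)) (ball (c j) (r j)))
    (z : E) (hz : ∀ i, z ≠ c i) : radialOutAll c r z ∈ (⋃ i, ball (c i) (r i))ᶜ := by
  rcases radialOutAll_cases c r z with ⟨i, hi, he⟩ | ⟨h, he⟩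
  · have hs := radialOut_mem_sphere (hr i) hi (hz i)
    rw [he]
    simp only [Set.mem_compl_iff, Set.mem_iUnion, not_exists]
    intro j hj
    by_cases hij : i = j
    · subst hij
      exact (ne_of_lt (mem_ball.1 hj)) (mem_sphere.1 hs)
    · have hd := (hdisj hij).closure_left isOpen_ball
      rw [closure_ball _ (hr i).ne'] at hd
      exact Set.disjoint_left.1 hd (sphere_subset_closedBall hs) hj
  · rw [he]
    simpa using h

lemma radialOutAll_continuousAt (c : ℕ → E) (r : ℕ → ℝ) (hr : ∀ i, 0 < r i)
    (hdisj : Pairwise fun i j => Disjoint (ball (c i) (r i)) (ball (c j) (r j)))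
    (hlim : Tendsto r atTop (𝓝 0))
    (z : E) (hz : ∀ i, z ≠ c i) : ContinuousAt (radialOutAll c r) z := by
  rcases radialOutAll_cases c r z with ⟨i, hi, -⟩ | ⟨h, he⟩
  · refine (radialOut_continuousAt (r := r i) (hz i)).congr ?_
    filter_upwards [isOpen_ball.mem_nhds hi] with w hw
    rcases radialOutAll_cases c r w with ⟨j, hj, hje⟩ | ⟨h, -⟩
    · by_cases hij : i = j
      · subst hij; exact hje.symm
      · exact absurd hj (Set.disjoint_left.1 (hdisj hij) hw)
    · exact absurd hw (h i)
  · rw [ContinuousAt, he, Metric.tendsto_nhds]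
    intro ε hε
    obtain ⟨N, hN⟩ := eventually_atTop.1 (hlim.eventually (gt_mem_nhds (show 0 < ε / 4 by linarith)))
    have hfin : ∀ᶠ w in 𝓝 z, ∀ i ∈ Finset.range N, dist (radialOut (c i) (r i) w) z < ε := by
      rw [Filter.eventually_all_finset]
      intro i _
      have := radialOut_continuousAt (r := r i) (hz i)
      rw [ContinuousAt, radialOut_of_notMem (hr i) (h i), Metric.tendsto_nhds] at this
      exact this ε hε
    have hc : ∀ᶠ w in 𝓝 z, dist w z < ε / 2 := ball_mem_nhds z (by linarith)
    filter_upwards [hfin, hc] with w hw1 hw2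
    rcases radialOutAll_cases c r w with ⟨i, hi, hie⟩ | ⟨-, hwe⟩
    · rw [hie]
      by_cases hiN : i < N
      · exact hw1 i (Finset.mem_range.2 hiN)
      · have h4 := hN i (not_lt.1 hiN)
        by_cases hwc : w = c i
        · have : radialOut (c i) (r i) w = w := by simp [radialOut, hwc]
          rw [this]; linarith
        · have h5 := radialOut_dist (hr i) hi hwc
          have h6 := dist_triangle (radialOut (c i) (r i) w) w z
          linarith
    · rw [hwe]; linarith

end

/-- The complement of a countable union of pairwise disjoint open balls whose radii
tend to zero in `ℝ^m`, `m ≥ 2`, is path-connected: any two of its points are joined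
by a path within the set. -/
theorem joinedIn_compl_iUnion_balls
    (m : ℕ) (hm : 2 ≤ m) (c : ℕ → EuclideanSpace ℝ (Fin m)) (r : ℕ → ℝ)
    (hr : ∀ i, 0 < r i)
    (hdisj : Pairwise fun i j => Disjoint (Metric.ball (c i) (r i)) (Metric.ball (c j) (r j)))
    (hlim : Filter.Tendsto r Filter.atTop (nhds 0))
    (x y : EuclideanSpace ℝ (Fin m))
    (hx : x ∈ (⋃ i, Metric.ball (c i) (r i))ᶜ)
    (hy : y ∈ (⋃ i, Metric.ball (c i) (r i))ᶜ) :
    JoinedIn ((⋃ i, Metric.ball (c i) (r i))ᶜ) x y := by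
  have hrank : 1 < Module.rank ℝ (EuclideanSpace ℝ (Fin m)) := by
    rw [← Module.finrank_eq_rank, finrank_euclideanSpace_fin]
    exact_mod_cast (show 1 < m by omega)
  have hpc := (Set.countable_range c).isPathConnected_compl_of_one_lt_rank hrank
  have hne : ∀ z ∈ (⋃ i, Metric.ball (c i) (r i))ᶜ, z ∈ (Set.range c)ᶜ := by
    rintro z hz ⟨i, rfl⟩
    exact hz (Set.mem_iUnion.2 ⟨i, mem_ball_self (hr i)⟩)
  have hfix : ∀ z ∈ (⋃ i, Metric.ball (c i) (r i))ᶜ, radialOutAll c r z = z := by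
    intro z hz
    rcases radialOutAll_cases c r z with ⟨i, hi, -⟩ | ⟨-, h⟩
    · exact absurd (Set.mem_iUnion.2 ⟨i, hi⟩) hz
    · exact h
  have hne' : ∀ z ∈ (Set.range c)ᶜ, ∀ i, z ≠ c i := fun z hz i h => hz ⟨i, h.symm⟩
  have himg := hpc.image' (f := radialOutAll c r) fun z hz =>
    (radialOutAll_continuousAt c r hr hdisj hlim z (hne' z hz)).continuousWithinAt
  refine (himg.joinedIn x ⟨x, hne x hx, hfix x hx⟩ y ⟨y, hne y hy, hfix y hy⟩).mono ?_
  rintro _ ⟨z, hz, rfl⟩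
  exact radialOutAll_mem c r hr hdisj z (hne' z hz)
end

section
/- Let m ≥ 2, and for each i ∈ ℕ let B(cᵢ, rᵢ) be an open ball in Euclidean space ℝ^m with rᵢ > 0. Suppose the balls B(cᵢ, rᵢ) are pairwise disjoint and the radii tend to zero, i.e., rᵢ → 0 as i → ∞. Then the set ℝ^m \ ( B̄(c₀, r₀) ∪ ⋃_{i≥1} B(cᵢ, rᵢ) ), i.e., the complement of the union of the closed ball B̄(c₀, r₀) with all the other open balls, is path-connected: any two of its points can be joined by a continuous path lying entirely in the set. -/
lemma aux_proj {E : Type*} [NormedAddCommGroup E] [NormedSpace ℝ E]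
    (c p : E) (r : ℝ) (hp : p ∈ Metric.ball c r) :
    ∃ ρ : E → E, ContinuousOn ρ {p}ᶜ ∧ (∀ z, z ∉ Metric.ball c r → ρ z = z) ∧
      ∀ z ∈ Metric.ball c r, z ≠ p → ρ z ∈ Metric.sphere c r ∧ z ∈ segment ℝ p (ρ z) := by
  have hr : 0 < r := Metric.pos_of_mem_ball hp
  set s : Set E := Metric.ball (c - p) r with hs
  have hconv : Convex ℝ s := convex_ball _ _
  have h0 : s ∈ nhds (0 : E) := by
    apply Metric.isOpen_ball.mem_nhds
    simpa [dist_eq_norm, hs, norm_sub_rev] using hp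
  have hmem : ∀ z, z - p ∈ s ↔ z ∈ Metric.ball c r := by
    intro z; simp [hs, dist_eq_norm]
  have habs : Absorbent ℝ s := absorbent_nhds_zero h0
  have hb : Bornology.IsVonNBounded ℝ s := NormedSpace.isVonNBounded_of_isBounded ℝ Metric.isBounded_ball
  have hpos : ∀ z, z ≠ p → 0 < gauge s (z - p) := fun z hz =>
    (gauge_pos habs hb).2 (sub_ne_zero.2 hz)
  have hlt : ∀ z, gauge s (z - p) < 1 ↔ z ∈ Metric.ball c r := by
    intro z
    rw [← hmem, gauge_lt_one_iff_mem_interior hconv h0, Metric.isOpen_ball.interior_eq]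
  have hcg : Continuous (gauge s) := continuous_gauge hconv h0
  refine ⟨fun z => p + (min 1 (gauge s (z - p)))⁻¹ • (z - p), ?_, ?_, ?_⟩
  · refine continuousOn_const.add (ContinuousOn.smul (ContinuousOn.inv₀ ?_ ?_) ?_)
    · exact (by fun_prop : Continuous fun z => min 1 (gauge s (z - p))).continuousOn
    · intro z hz
      have := hpos z hz
      exact (lt_min one_pos this).ne'
    · fun_prop
  · intro z hz
    rw [← hlt, not_lt] at hz
    simp [min_eq_left hz]
  · intro z hz hzp
    have h1 := (hlt z).2 hz
    have h2 := hpos z hzp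
    simp only [min_eq_right h1.le]
    constructor
    · have : gauge s ((gauge s (z - p))⁻¹ • (z - p)) = 1 := by
        rw [gauge_smul_of_nonneg (inv_nonneg.2 h2.le), smul_eq_mul, inv_mul_cancel₀ h2.ne']
      rw [gauge_eq_one_iff_mem_frontier hconv h0, hs, frontier_ball _ hr.ne'] at this
      rw [mem_sphere_iff_norm] at this ⊢
      rw [← this]; congr 1; abel
    · rw [segment_eq_image']
      refine ⟨gauge s (z - p), ⟨h2.le, h1.le⟩, ?_⟩
      simp [smul_smul, h2.ne']

lemma aux_path {m : ℕ} (hm : 2 ≤ m) (c : EuclideanSpace ℝ (Fin m)) (r : ℝ) (hr : 0 < r)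
    (Q : Set (EuclideanSpace ℝ (Fin m))) (hQ : Q.Countable) :
    IsPathConnected ((Metric.closedBall c r)ᶜ ∩ Qᶜ) := by
  set f : EuclideanSpace ℝ (Fin m) → EuclideanSpace ℝ (Fin m) :=
    fun v => c + (1 + r / ‖v‖) • v with hf
  set g : EuclideanSpace ℝ (Fin m) → EuclideanSpace ℝ (Fin m) :=
    fun z => (1 - r / ‖z - c‖) • (z - c) with hg
  have hfn : ∀ v, v ≠ 0 → ‖f v - c‖ = ‖v‖ + r := by
    intro v hv
    have hv' : 0 < ‖v‖ := norm_pos_iff.2 hv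
    simp only [hf, add_sub_cancel_left, norm_smul, Real.norm_eq_abs]
    rw [abs_of_pos (by positivity)]
    field_simp
  have hgf : ∀ v, v ≠ 0 → g (f v) = v := by
    intro v hv
    have hv' : 0 < ‖v‖ := norm_pos_iff.2 hv
    have : g (f v) = (1 - r / (‖v‖ + r)) • ((1 + r / ‖v‖) • v) := by
      simp only [hg, hfn v hv]
      simp [hf]
    rw [this, smul_smul]
    have : (1 - r / (‖v‖ + r)) * (1 + r / ‖v‖) = 1 := by
      field_simp
      ring
    rw [this, one_smul]
  have hfg : ∀ z, z ∉ Metric.closedBall c r → g z ≠ 0 ∧ f (g z) = z := by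
    intro z hz
    rw [mem_closedBall_iff_norm, not_le] at hz
    have hz0 : 0 < ‖z - c‖ := hr.trans hz
    have hco : 0 < 1 - r / ‖z - c‖ := by rw [sub_pos, div_lt_one hz0]; exact hz
    have hn : ‖g z‖ = ‖z - c‖ - r := by
      simp only [hg, norm_smul, Real.norm_eq_abs]
      rw [abs_of_pos hco]; field_simp
    refine ⟨by rw [← norm_pos_iff, hn]; linarith, ?_⟩
    have h1 : ‖z - c‖ - r ≠ 0 := by linarith
    have : f (g z) = c + ((1 + r / (‖z - c‖ - r)) * (1 - r / ‖z - c‖)) • (z - c) := by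
      simp only [hf, hn]
      simp only [hg, smul_smul]
    rw [this]
    have : (1 + r / (‖z - c‖ - r)) * (1 - r / ‖z - c‖) = 1 := by
      field_simp
      ring
    rw [this]; simp
  set A : Set (EuclideanSpace ℝ (Fin m)) := {v | v = 0 ∨ f v ∈ Q} with hA
  have hAc : A.Countable := by
    refine ((hQ.image g).insert 0).mono ?_
    rintro v (hv | hv)
    · exact Or.inl hv
    · by_cases h : v = 0
      · exact Or.inl h
      · exact Or.inr ⟨f v, hv, hgf v h⟩
  have hrank : 1 < Module.rank ℝ (EuclideanSpace ℝ (Fin m)) := by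
    rw [← Module.finrank_eq_rank, finrank_euclideanSpace_fin]
    exact_mod_cast hm
  have hpc := hAc.isPathConnected_compl_of_one_lt_rank hrank
  have himg : f '' Aᶜ = (Metric.closedBall c r)ᶜ ∩ Qᶜ := by
    ext z
    constructor
    · rintro ⟨v, hv, rfl⟩
      simp only [hA, Set.mem_compl_iff, Set.mem_setOf_eq, not_or] at hv
      refine ⟨?_, hv.2⟩
      rw [Set.mem_compl_iff, mem_closedBall_iff_norm, hfn v hv.1]
      have := norm_pos_iff.2 hv.1
      linarith
    · rintro ⟨h1, h2⟩
      obtain ⟨h3, h4⟩ := hfg z h1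
      refine ⟨g z, ?_, h4⟩
      rintro (h | h)
      · exact h3 h
      · rw [h4] at h; exact h2 h
  rw [← himg]
  apply hpc.image'
  refine continuousOn_const.add (ContinuousOn.smul (continuousOn_const.add
    (continuousOn_const.div continuous_norm.continuousOn ?_)) continuousOn_id)
  intro v hv
  exact norm_ne_zero_iff.2 fun h => hv (Or.inl h)

/-- Open balls that are disjoint: the closed version of one misses the other. -/
lemma aux_closed {E : Type*} [NormedAddCommGroup E] [NormedSpace ℝ E]
    {c d : E} {r s : ℝ} (hr : 0 < r)
    (h : Disjoint (Metric.ball c r) (Metric.ball d s)) :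
    Disjoint (Metric.closedBall c r) (Metric.ball d s) := by
  rw [← closure_ball c hr.ne']
  exact h.closure_left Metric.isOpen_ball

/-- Combining the retractions of disjoint balls with radii tending to zero. -/
lemma aux_glue {E : Type*} [NormedAddCommGroup E] [NormedSpace ℝ E]
    (c : ℕ → E) (r : ℕ → ℝ)
    (hdisj : Pairwise fun i j => Disjoint (Metric.ball (c i) (r i)) (Metric.ball (c j) (r j)))
    (hlim : Filter.Tendsto r Filter.atTop (nhds 0)) (K : Set E) (ρ : ℕ → E → E)
    (hc : ∀ i, ContinuousOn (ρ i) K)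
    (hid : ∀ i, ∀ z, z ∉ Metric.ball (c i) (r i) → ρ i z = z)
    (hin : ∀ i, ∀ z ∈ K, z ∈ Metric.ball (c i) (r i) → ρ i z ∈ Metric.sphere (c i) (r i)) :
    ∃ Φ : E → E, ContinuousOn Φ K ∧ (∀ z, (∀ i, z ∉ Metric.ball (c i) (r i)) → Φ z = z) ∧
      ∀ i, ∀ z ∈ Metric.ball (c i) (r i), Φ z = ρ i z := by
  classical
  have huniq : ∀ i j z, z ∈ Metric.ball (c i) (r i) → z ∈ Metric.ball (c j) (r j) → i = j := by
    intro i j z hi hj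
    by_contra hne
    exact Set.disjoint_left.1 (hdisj hne) hi hj
  let Φ : E → E := fun z => if h : ∃ i, z ∈ Metric.ball (c i) (r i) then ρ h.choose z else z
  have hΦ2 : ∀ i, ∀ z ∈ Metric.ball (c i) (r i), Φ z = ρ i z := by
    intro i z hz
    have h : ∃ i, z ∈ Metric.ball (c i) (r i) := ⟨i, hz⟩
    simp only [Φ, dif_pos h]
    rw [huniq _ _ z h.choose_spec hz]
  have hΦ1 : ∀ z, (∀ i, z ∉ Metric.ball (c i) (r i)) → Φ z = z := by
    intro z hz
    have h : ¬ ∃ i, z ∈ Metric.ball (c i) (r i) := fun ⟨i, hi⟩ => hz i hi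
    simp only [Φ, dif_neg h]
  refine ⟨Φ, ?_, hΦ1, hΦ2⟩
  let F : ℕ → E → E := fun n z => z + ∑ i ∈ Finset.range n, (ρ i z - z)
  have hF : ∀ n, ContinuousOn (F n) K := fun n =>
    continuousOn_id.add (continuousOn_finsetSum _ fun i _ => (hc i).sub continuousOn_id)
  have hu : TendstoUniformlyOn F Φ Filter.atTop K := by
    rw [Metric.tendstoUniformlyOn_iff]
    intro ε hε
    have h1 := hlim.eventually (gt_mem_nhds (show (0 : ℝ) < ε / 2 by positivity))
    obtain ⟨N, hN⟩ := Filter.eventually_atTop.1 h1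
    filter_upwards [Filter.eventually_ge_atTop N] with n hn z hz
    by_cases h : ∃ i, z ∈ Metric.ball (c i) (r i)
    · obtain ⟨i, hi⟩ := h
      have hz' : ∀ j, j ≠ i → ρ j z - z = 0 := by
        intro j hj
        rw [hid j z fun hjz => hj (huniq _ _ z hjz hi), sub_self]
      rw [hΦ2 i z hi]
      by_cases hin' : i < n
      · have : F n z = ρ i z := by
          simp only [F]
          rw [Finset.sum_eq_single i (fun j _ hj => hz' j hj)
            (fun h => absurd (Finset.mem_range.2 hin') h)]
          abel
        rw [this, dist_self]; exact hε
      · have : F n z = z := by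
          simp only [F]
          rw [Finset.sum_eq_zero, add_zero]
          intro j hj
          apply hz'
          rintro rfl
          exact hin' (Finset.mem_range.1 hj)
        rw [this]
        have h2 := hin i z hz hi
        have h3 := hN i (by omega)
        rw [Metric.mem_sphere] at h2
        rw [Metric.mem_ball] at hi
        have := dist_triangle_right (ρ i z) z (c i)
        linarith
    · push Not at h
      have : F n z = z := by
        simp only [F]
        rw [Finset.sum_eq_zero, add_zero]
        intro j _
        rw [hid j z (h j), sub_self]
      rw [hΦ1 z h, this, dist_self]; exact hε
  exact hu.continuousOn (Filter.Frequently.of_forall hF)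


/-- Given pairwise disjoint open balls in `ℝ^m`, `m ≥ 2`, with radii tending to zero,
the complement of the union of the *closed* ball of index `0` with the remaining open
balls is path-connected: any two of its points are joined by a path within the set. -/
theorem joinedIn_compl_closedBall_union_balls
    (m : ℕ) (hm : 2 ≤ m) (c : ℕ → EuclideanSpace ℝ (Fin m)) (r : ℕ → ℝ)
    (hr : ∀ i, 0 < r i)
    (hdisj : Pairwise fun i j => Disjoint (Metric.ball (c i) (r i)) (Metric.ball (c j) (r j)))
    (hlim : Filter.Tendsto r Filter.atTop (nhds 0))
    (x y : EuclideanSpace ℝ (Fin m))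
    (hx : x ∈ (Metric.closedBall (c 0) (r 0) ∪ ⋃ i ∈ Set.Ici 1, Metric.ball (c i) (r i))ᶜ)
    (hy : y ∈ (Metric.closedBall (c 0) (r 0) ∪ ⋃ i ∈ Set.Ici 1, Metric.ball (c i) (r i))ᶜ) :
    JoinedIn ((Metric.closedBall (c 0) (r 0) ∪ ⋃ i ∈ Set.Ici 1, Metric.ball (c i) (r i))ᶜ) x y := by
  have hx' := hx
  have hy' := hy
  simp only [Set.mem_compl_iff, Set.mem_union, Set.mem_iUnion, Set.mem_Ici, not_or, not_exists] at hx' hy'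
  have hm' : Nontrivial (EuclideanSpace ℝ (Fin m)) := by
    have : Nonempty (Fin m) := ⟨⟨0, by omega⟩⟩
    infer_instance
  obtain ⟨Q₀, hQ₀c, hQ₀d⟩ := TopologicalSpace.exists_countable_dense (EuclideanSpace ℝ (Fin m))
  set Q := Q₀ \ {x, y} with hQdef
  have hQc : Q.Countable := hQ₀c.mono Set.diff_subset
  have hQd : Dense Q := hQ₀d.diff_finite (Set.toFinite _)
  have hJ : JoinedIn ((Metric.closedBall (c 0) (r 0))ᶜ ∩ Qᶜ) x y :=
    (aux_path hm (c 0) (r 0) (hr 0) Q hQc).joinedIn x ⟨hx'.1, fun h => h.2 (by simp)⟩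
      y ⟨hy'.1, fun h => h.2 (by simp)⟩
  obtain ⟨γ, hγ⟩ := hJ
  have hKc : IsCompact (Set.range γ) := isCompact_range γ.continuous
  have hKd : Disjoint (Set.range γ) (Metric.closedBall (c 0) (r 0)) := by
    rw [Set.disjoint_left]
    rintro _ ⟨t, rfl⟩
    exact (hγ t).1
  obtain ⟨δ, hδ, hsep⟩ := hKd.exists_thickenings hKc Metric.isClosed_closedBall
  have hsep' : ∀ t, ∀ w ∈ Metric.closedBall (c 0) (r 0), δ ≤ dist (γ t) w := by
    intro t w hw
    by_contra hlt
    push Not at hlt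
    refine Set.disjoint_left.1 hsep (Metric.self_subset_thickening hδ _ ⟨t, rfl⟩) ?_
    exact Metric.mem_thickening_iff.2 ⟨w, hw, hlt⟩
  -- choice of the centers of projection
  have hp : ∀ i : ℕ, ∃ p ∈ Q, p ∈ Metric.ball (c (i+1)) (r (i+1)) ∧
      ∀ w ∈ Metric.closedBall (c 0) (r 0), w ∈ Metric.closedBall (c (i+1)) (r (i+1)) →
        dist p w < δ := by
    intro i
    by_cases hex : ∃ w ∈ Metric.closedBall (c 0) (r 0), w ∈ Metric.closedBall (c (i+1)) (r (i+1))
    · obtain ⟨w, hw0, hwi⟩ := hex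
      have hwc : w ∈ closure (Metric.ball (c (i+1)) (r (i+1))) := by
        rwa [closure_ball _ (hr _).ne']
      have hne : (Metric.ball w δ ∩ Metric.ball (c (i+1)) (r (i+1))).Nonempty :=
        mem_closure_iff.1 hwc _ Metric.isOpen_ball (Metric.mem_ball_self hδ)
      obtain ⟨p, ⟨hp1, hp2⟩, hpQ⟩ :=
        hQd.inter_open_nonempty _ (Metric.isOpen_ball.inter Metric.isOpen_ball) hne
      refine ⟨p, hpQ, hp2, ?_⟩
      intro w' hw0' hwi'
      have : w' = w := by
        by_contra hww
        have h1 := combo_mem_ball_of_ne hw0' hw0 hww (a := 1/2) (b := 1/2)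
          (by norm_num) (by norm_num) (by norm_num)
        have h2 := combo_mem_ball_of_ne hwi' hwi hww (a := 1/2) (b := 1/2)
          (by norm_num) (by norm_num) (by norm_num)
        exact Set.disjoint_left.1 (hdisj (Nat.succ_ne_zero i).symm) h1 h2
      rw [this]; exact hp1
    · obtain ⟨p, hp2, hpQ⟩ := hQd.inter_open_nonempty _ Metric.isOpen_ball
        ⟨c (i+1), Metric.mem_ball_self (hr (i+1))⟩
      exact ⟨p, hpQ, hp2, fun w h1 h2 => absurd ⟨w, h1, h2⟩ hex⟩
  choose p hpQ hpB hpδ using hp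
  choose ρ hρc hρid hρin using fun i => aux_proj (c (i+1)) (p i) (r (i+1)) (hpB i)
  have hne : ∀ i t, γ t ≠ p i := fun i t h => (hγ t).2 (h ▸ hpQ i)
  obtain ⟨Φ, hΦc, hΦid, hΦin⟩ := aux_glue (fun i => c (i+1)) (fun i => r (i+1))
    (fun i j hij => hdisj (fun h => hij (Nat.succ_injective h)))
    (hlim.comp (Filter.tendsto_add_atTop_nat 1)) (Set.range γ) ρ
    (fun i => (hρc i).mono (by rintro _ ⟨t, rfl⟩; exact hne i t)) hρid
    (by rintro i _ ⟨t, rfl⟩ h; exact (hρin i _ h (hne i t)).1)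
  have hΦx : Φ x = x := hΦid x fun i => hx'.2 (i+1) (by omega)
  have hΦy : Φ y = y := hΦid y fun i => hy'.2 (i+1) (by omega)
  refine ⟨(γ.map' hΦc).cast hΦx.symm hΦy.symm, fun t => ?_⟩
  change Φ (γ t) ∈ _
  simp only [Set.mem_compl_iff, Set.mem_union, Set.mem_iUnion, Set.mem_Ici, not_or, not_exists]
  by_cases h : ∃ i, γ t ∈ Metric.ball (c (i+1)) (r (i+1))
  · obtain ⟨i, hi⟩ := h
    obtain ⟨hs, hseg⟩ := hρin i _ hi (hne i t)
    rw [hΦin i _ hi]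
    constructor
    · intro h0
      have h1 := hpδ i _ h0 (Metric.sphere_subset_closedBall hs)
      have h2 := hsep' t _ h0
      have h3 := dist_add_dist_of_mem_segment hseg
      have h4 := dist_nonneg (x := p i) (y := γ t)
      linarith
    · intro j hj hb
      by_cases hij : i + 1 = j
      · subst hij
        rw [Metric.mem_ball, Metric.mem_sphere.1 hs] at hb
        exact lt_irrefl _ hb
      · exact Set.disjoint_left.1 (aux_closed (hr (i+1)) (hdisj hij))
          (Metric.sphere_subset_closedBall hs) hb
  · push Not at h
    rw [hΦid _ h]
    refine ⟨(hγ t).1, fun j hj hb => ?_⟩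
    obtain ⟨i, rfl⟩ : ∃ i, j = i + 1 := ⟨j - 1, by omega⟩
    exact h i hb
end

section
/- Let m ≥ 2, let c ∈ ℝ^m and r > 0, and let S = S(c, r) be the sphere of center c and radius r in Euclidean space ℝ^m. Let x, y, z be points of S with z ≠ x and z ≠ y. Then there exists a continuous path γ : [0,1] → ℝ^m with γ(0) = x, γ(1) = y whose image is contained in S \ {z}, and which is Lipschitz with Lipschitz constant 2πr (so that its length is at most 2πr). -/
theorem detour_exists_perp (m : ℕ) (hm : 2 ≤ m) (p : EuclideanSpace ℝ (Fin m)) :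
    ∃ f : EuclideanSpace ℝ (Fin m), f ≠ 0 ∧ inner ℝ p f = 0 := by
  have hne : (Submodule.span ℝ {p})ᗮ ≠ ⊥ := by
    intro h
    rw [Submodule.orthogonal_eq_bot_iff] at h
    have h1 : Module.finrank ℝ (Submodule.span ℝ {p}) ≤ 1 := by
      simpa using finrank_span_le_card (R := ℝ) ({p} : Set (EuclideanSpace ℝ (Fin m)))
    rw [h, finrank_top, finrank_euclideanSpace_fin] at h1
    omega
  obtain ⟨f, hf, hf0⟩ := Submodule.exists_mem_ne_zero_of_ne_bot hne
  exact ⟨f, hf0, Submodule.mem_orthogonal_singleton_iff_inner_right.1 hf⟩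

theorem detour_norm_sq {E : Type*} [NormedAddCommGroup E] [InnerProductSpace ℝ E]
    (p f : E) (r : ℝ) (hp : ‖p‖ = r) (hf : ‖f‖ = r) (hpf : inner ℝ p f = 0) (a b : ℝ) :
    ‖a • p + b • f‖ ^ 2 = r ^ 2 * (a ^ 2 + b ^ 2) := by
  rw [norm_add_sq_real, norm_smul, norm_smul, real_inner_smul_left, real_inner_smul_right,
    hpf, hp, hf, mul_pow, mul_pow, Real.norm_eq_abs, Real.norm_eq_abs, sq_abs, sq_abs]
  ring

/-- scaling a nonzero vector to norm `r` -/
theorem detour_scale {E : Type*} [NormedAddCommGroup E] [InnerProductSpace ℝ E]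
    (g : E) (r : ℝ) (hr : 0 < r) (hg : g ≠ 0) : ‖(r / ‖g‖) • g‖ = r := by
  have : 0 < ‖g‖ := norm_pos_iff.2 hg
  rw [norm_smul, Real.norm_eq_abs, abs_of_pos (by positivity)]
  field_simp

theorem detour_frame (m : ℕ) (hm : 2 ≤ m) (r : ℝ) (hr : 0 < r)
    (p q : EuclideanSpace ℝ (Fin m)) (hp : ‖p‖ = r) (hq : ‖q‖ = r) :
    ∃ f : EuclideanSpace ℝ (Fin m), ∃ θ : ℝ, ‖f‖ = r ∧ inner ℝ p f = 0 ∧ 0 ≤ θ ∧ θ ≤ Real.pi ∧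
      q = Real.cos θ • p + Real.sin θ • f := by
  set d : ℝ := inner ℝ p q / r ^ 2 with hd
  have hpq : inner ℝ p q = d * r ^ 2 := by rw [hd]; field_simp
  have hperp : inner ℝ p (q - d • p) = 0 := by
    rw [inner_sub_right, real_inner_smul_right, real_inner_self_eq_norm_sq, hp, hpq]; ring
  have key : ∃ f : EuclideanSpace ℝ (Fin m), ∃ s : ℝ, ‖f‖ = r ∧ inner ℝ p f = 0 ∧ 0 ≤ s ∧
      q = d • p + s • f := by
    by_cases h0 : q - d • p = 0
    · obtain ⟨g, hg, hpg⟩ := detour_exists_perp m hm p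
      refine ⟨(r / ‖g‖) • g, 0, detour_scale g r hr hg, ?_, le_rfl, ?_⟩
      · rw [real_inner_smul_right, hpg, mul_zero]
      · rw [zero_smul, add_zero]; exact sub_eq_zero.1 h0
    · have hn : 0 < ‖q - d • p‖ := norm_pos_iff.2 h0
      refine ⟨(r / ‖q - d • p‖) • (q - d • p), ‖q - d • p‖ / r, detour_scale _ r hr h0, ?_,
        by positivity, ?_⟩
      · rw [real_inner_smul_right, hperp, mul_zero]
      · rw [smul_smul]
        have : ‖q - d • p‖ / r * (r / ‖q - d • p‖) = 1 := by field_simp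
        rw [this, one_smul]; abel
  obtain ⟨f, s, hf, hpf, hs, hqe⟩ := key
  have h1 := detour_norm_sq p f r hp hf hpf d s
  rw [← hqe, hq] at h1
  have h2 : d ^ 2 + s ^ 2 = 1 := by
    have : r ^ 2 ≠ 0 := by positivity
    apply mul_left_cancel₀ this
    linarith
  refine ⟨f, Real.arccos d, hf, hpf, Real.arccos_nonneg d, Real.arccos_le_pi d, ?_⟩
  rw [Real.cos_arccos (by nlinarith) (by nlinarith), Real.sin_arccos,
    show 1 - d ^ 2 = s ^ 2 by linarith, Real.sqrt_sq hs]
  exact hqe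

theorem detour_dist {E : Type*} [NormedAddCommGroup E] [InnerProductSpace ℝ E]
    (c p f : E) (r : ℝ) (hr : 0 < r) (hp : ‖p‖ = r) (hf : ‖f‖ = r) (hpf : inner ℝ p f = 0)
    (a b : ℝ) :
    dist (c + (Real.cos a • p + Real.sin a • f)) (c + (Real.cos b • p + Real.sin b • f))
      ≤ r * |a - b| := by
  rw [dist_add_left, dist_eq_norm]
  have h : (Real.cos a • p + Real.sin a • f) - (Real.cos b • p + Real.sin b • f)
      = (Real.cos a - Real.cos b) • p + (Real.sin a - Real.sin b) • f := by
    module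
  rw [h]
  refine abs_le_of_sq_le_sq' ?_ (by positivity) |>.2
  rw [detour_norm_sq p f r hp hf hpf, mul_pow, sq_abs]
  apply mul_le_mul_of_nonneg_left _ (by positivity)
  have h1 := Real.one_sub_sq_div_two_le_cos (x := a - b)
  rw [Real.cos_sub] at h1
  nlinarith [Real.sin_sq_add_cos_sq a, Real.sin_sq_add_cos_sq b]

theorem detour_arc {E : Type*} [NormedAddCommGroup E] [InnerProductSpace ℝ E]
    (c p f x y z : E) (r : ℝ) (hr : 0 < r) (hp : ‖p‖ = r) (hf : ‖f‖ = r)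
    (hpf : inner ℝ p f = 0) (φ : ℝ) (h0 : 0 ≤ φ) (h2 : φ ≤ 2 * Real.pi)
    (hx : x = c + p) (hy : y = c + (Real.cos φ • p + Real.sin φ • f))
    (hz : ∀ a, 0 ≤ a → a ≤ φ → z ≠ c + (Real.cos a • p + Real.sin a • f)) :
    ∃ γ : Path x y, (∀ t, γ t ∈ Metric.sphere c r \ {z}) ∧
      LipschitzWith (Real.toNNReal (2 * Real.pi * r)) γ := by
  refine ⟨⟨⟨fun t => c + (Real.cos (t * φ) • p + Real.sin (t * φ) • f), by fun_prop⟩,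
    by simp [hx], by simp [hy]⟩, ?_, ?_⟩
  · intro t
    refine ⟨?_, ?_⟩
    · change dist (c + (Real.cos (t * φ) • p + Real.sin (t * φ) • f)) c = r
      rw [dist_eq_norm, add_sub_cancel_left]
      have := detour_norm_sq p f r hp hf hpf (Real.cos (t * φ)) (Real.sin (t * φ))
      rw [Real.cos_sq_add_sin_sq, mul_one] at this
      exact (sq_eq_sq₀ (norm_nonneg _) hr.le).1 this
    · intro h
      exact hz (t * φ) (mul_nonneg t.2.1 h0) (mul_le_of_le_one_left h0 t.2.2)
        (Eq.symm (Set.mem_singleton_iff.1 h))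
  · apply LipschitzWith.of_dist_le_mul
    intro s t
    rw [Real.coe_toNNReal _ (by positivity)]
    refine (detour_dist c p f r hr hp hf hpf (s * φ) (t * φ)).trans ?_
    rw [← sub_mul, abs_mul, abs_of_nonneg h0, Subtype.dist_eq, Real.dist_eq]
    have : |(s : ℝ) - t| * φ ≤ |(s : ℝ) - t| * (2 * Real.pi) :=
      mul_le_mul_of_nonneg_left h2 (abs_nonneg _)
    nlinarith

/-- Detour lemma: any two points `x, y` of a sphere of radius `r` in `ℝ^m`, `m ≥ 2`, can be
joined by a path on the sphere avoiding a prescribed point `z` (with `z ≠ x`, `z ≠ y`) which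
is Lipschitz with constant `2πr`, hence of length at most `2πr`. -/
theorem exists_path_on_sphere_avoiding
    (m : ℕ) (hm : 2 ≤ m) (c : EuclideanSpace ℝ (Fin m)) (r : ℝ) (hr : 0 < r)
    (x y z : EuclideanSpace ℝ (Fin m))
    (hx : x ∈ Metric.sphere c r) (hy : y ∈ Metric.sphere c r) (hz : z ∈ Metric.sphere c r)
    (hzx : z ≠ x) (hzy : z ≠ y) :
    ∃ γ : Path x y, (∀ t, γ t ∈ Metric.sphere c r \ {z}) ∧
      LipschitzWith (Real.toNNReal (2 * Real.pi * r)) γ := by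
  have hp : ‖x - c‖ = r := mem_sphere_iff_norm.1 hx
  have hq : ‖y - c‖ = r := mem_sphere_iff_norm.1 hy
  obtain ⟨f, θ, hf, hpf, h0, hpi, hqe⟩ := detour_frame m hm r hr (x - c) (y - c) hp hq
  have hxe : x = c + (x - c) := by abel
  have hye : y = c + (Real.cos θ • (x - c) + Real.sin θ • f) := by rw [← hqe]; abel
  have hpos := Real.pi_pos
  by_cases hA : ∀ a, 0 ≤ a → a ≤ θ → z ≠ c + (Real.cos a • (x - c) + Real.sin a • f)
  · exact detour_arc c (x - c) f x y z r hr hp hf hpf θ h0 (by linarith) hxe hye hA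
  · push Not at hA
    obtain ⟨a, ha0, haθ, hza⟩ := hA
    refine detour_arc c (x - c) (-f) x y z r hr hp (by rwa [norm_neg])
      (by rw [inner_neg_right, hpf, neg_zero]) (2 * Real.pi - θ) (by linarith) (by linarith) hxe
      (by rw [Real.cos_two_pi_sub, Real.sin_two_pi_sub, neg_smul_neg]; exact hye) ?_
    intro b hb0 hbθ hzb
    rw [hza] at hzb
    have h1 := add_left_cancel hzb
    have h2 : (Real.cos a - Real.cos b) • (x - c) + (Real.sin a + Real.sin b) • f = 0 := by
      rw [smul_neg] at h1
      rw [sub_smul, add_smul, ← sub_eq_zero.2 h1]; abel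
    have h3 := detour_norm_sq (x - c) f r hp hf hpf (Real.cos a - Real.cos b)
      (Real.sin a + Real.sin b)
    rw [h2, norm_zero] at h3
    have h4 : (Real.cos a - Real.cos b) ^ 2 + (Real.sin a + Real.sin b) ^ 2 = 0 := by
      have hr2 : r ^ 2 ≠ 0 := by positivity
      apply mul_left_cancel₀ hr2
      linarith
    have h5 : Real.cos (a + b) = 1 := by
      rw [Real.cos_add]
      nlinarith [Real.sin_sq_add_cos_sq a, Real.sin_sq_add_cos_sq b]
    by_cases hlt : a + b < 2 * Real.pi
    · have h6 := (Real.cos_eq_one_iff_of_lt_of_lt (by linarith) hlt).1 h5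
      have ha : a = 0 := by linarith
      apply hzx
      rw [hza, ha]; simp
    · have ha : a = θ := by linarith
      apply hzy
      rw [hza, ha, ← hye]
end
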